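/- Let α1, α2 > 0, λ ≥ 0, set α⁺ = α1 + α2, and let r ∈ ℕ. Then Σ_{k=0}^{∞} (e^{−λ/2}(λ/2)^k/k!) · (α1)_r/(α⁺+k)_r = [(α1)_r/(α⁺)_r] · e^{−λ/2} · _1F_1(α⁺; α⁺+r; λ/2). -/

import Mathlib

open scoped Nat

/-- Ascending factorial (Pochhammer symbol) `(a)_n = a(a+1)⋯(a+n-1)` for a real `a`. -/
noncomputable def asc (a : ℝ) (n : ℕ) : ℝ := Polynomial.eval a (ascPochhammer ℝ n)

/-- Kummer's confluent hypergeometric function `₁F₁(a;b;z)`. -/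
noncomputable def F11 (a b z : ℝ) : ℝ := ∑' k : ℕ, asc a k / asc b k * z ^ k / (k ! : ℝ)

theorem asc_add (a : ℝ) (m n : ℕ) : asc a (m + n) = asc a m * asc (a + m) n := by
  simp [asc, ← ascPochhammer_mul]

theorem asc_pos {a : ℝ} (ha : 0 < a) (n : ℕ) : 0 < asc a n :=
  ascPochhammer_pos n a ha

theorem asc_mul_asc_comm (a : ℝ) (m n : ℕ) :
    asc a m * asc (a + m) n = asc a n * asc (a + n) m := by
  rw [← asc_add, add_comm, asc_add]

/-- Moments about zero of the type 2 non-central beta distribution: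
the `r`-th moment (the Poisson-weighted mixture of beta moments) equals
`[(α1)_r/(α⁺)_r] e^{−λ/2} ₁F₁(α⁺; α⁺+r; λ/2)`. -/
theorem ncBeta2_moment (α1 α2 lam : ℝ)
    (hα1 : 0 < α1) (hα2 : 0 < α2) (hlam : 0 ≤ lam) (r : ℕ) :
    (∑' k : ℕ, (Real.exp (-(lam / 2)) * (lam / 2) ^ k / (k ! : ℝ)) *
        (asc α1 r / asc (α1 + α2 + k) r)) =
      (asc α1 r / asc (α1 + α2) r) * Real.exp (-(lam / 2)) *
        F11 (α1 + α2) (α1 + α2 + r) (lam / 2) := by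
  have ha : 0 < α1 + α2 := add_pos hα1 hα2
  rw [F11, ← tsum_mul_left]
  refine tsum_congr fun k => ?_
  have h₁ := (asc_pos ha r).ne'
  have h₂ := (asc_pos (a := α1 + α2 + k) (by positivity) r).ne'
  have h₃ := (asc_pos (a := α1 + α2 + r) (by positivity) k).ne'
  field_simp
  linear_combination -(lam / 2) ^ k * asc α1 r * asc_mul_asc_comm (α1 + α2) k r
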